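/- Let f ∈ 𝒦 have radius of convergence R > 0 and fulcrum F. Assume f is Gaussian and that for some even integer n ≥ 4 one has limsup_{s↑ln R} |F^{(j)}(s)|/F″(s)^{j/2} < +∞ for every 3 ≤ j ≤ n. Then lim_{s↑ln R} F^{(j)}(s)/F″(s)^{j/2} = 0 for every 3 ≤ j < n. -/

import Mathlib

open scoped BigOperators Topology
open Filter

namespace KhinchinPaper

/-- Sum of the power series with coefficients `a` at `t`. -/
noncomputable def fsum (a : ℕ → ℝ) (t : ℝ) : ℝ := ∑' n : ℕ, a n * t ^ n

/-- The class `𝒦`: non-constant power series with non-negative coefficients, `a 0 > 0`,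
and radius of convergence `R > 0`. -/
structure IsK (a : ℕ → ℝ) (R : ℝ) : Prop where
  pos₀ : 0 < a 0
  nonneg : ∀ n, 0 ≤ a n
  nonconst : ∃ n, 0 < n ∧ 0 < a n
  Rpos : 0 < R
  conv : ∀ t : ℝ, 0 ≤ t → t < R → Summable fun n : ℕ => a n * t ^ n
  radius : ∀ t : ℝ, R < t → ¬ Summable fun n : ℕ => a n * t ^ n

/-- Mean function `m_f(t) = t f'(t)/f(t)`. -/
noncomputable def mf (a : ℕ → ℝ) (t : ℝ) : ℝ :=
  (∑' n : ℕ, (n : ℝ) * a n * t ^ n) / fsum a t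

/-- Variance function `σ_f²(t)`. -/
noncomputable def sigma2 (a : ℕ → ℝ) (t : ℝ) : ℝ :=
  (∑' n : ℕ, (n : ℝ) ^ 2 * a n * t ^ n) / fsum a t - (mf a t) ^ 2

noncomputable def sigma (a : ℕ → ℝ) (t : ℝ) : ℝ := Real.sqrt (sigma2 a t)

/-- `k`-th moment of the normalized Khinchin family variable `X̆_t`. -/
noncomputable def normMoment (a : ℕ → ℝ) (t : ℝ) (k : ℕ) : ℝ :=
  ∑' n : ℕ, (a n * t ^ n / fsum a t) * (((n : ℝ) - mf a t) / sigma a t) ^ k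

/-- `k`-th central moment of `X_t`. -/
noncomputable def centralMoment (a : ℕ → ℝ) (t : ℝ) (k : ℕ) : ℝ :=
  ∑' n : ℕ, (a n * t ^ n / fsum a t) * ((n : ℝ) - mf a t) ^ k

/-- Characteristic function `E(e^{iθ X̆_t})` of the normalized variable. -/
noncomputable def charfun (a : ℕ → ℝ) (t θ : ℝ) : ℂ :=
  ∑' n : ℕ, ((a n * t ^ n / fsum a t : ℝ) : ℂ) *
    Complex.exp (Complex.I * (θ : ℂ) * ((((n : ℝ) - mf a t) / sigma a t : ℝ) : ℂ))

/-- `f` is Gaussian: `X̆_t → N(0,1)` in distribution as `t ↑ R`, expressed via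
pointwise convergence of characteristic functions (Lévy's continuity theorem). -/
def IsGaussian (a : ℕ → ℝ) (R : ℝ) : Prop :=
  ∀ θ : ℝ, Tendsto (fun t => charfun a t θ) (𝓝[<] R)
    (𝓝 (Complex.exp (-(θ : ℂ) ^ 2 / 2)))

/-- Gaussian for entire `f` (radius `R = ∞`, so `t → +∞`). -/
def IsGaussianEntire (a : ℕ → ℝ) : Prop :=
  ∀ θ : ℝ, Tendsto (fun t => charfun a t θ) atTop
    (𝓝 (Complex.exp (-(θ : ℂ) ^ 2 / 2)))

/-- The fulcrum `F(s) = log f(e^s)` restricted to the real axis. -/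
noncomputable def fulcrum (a : ℕ → ℝ) (s : ℝ) : ℝ := Real.log (fsum a (Real.exp s))

/-- The quotient `F^{(j)}(s) / F''(s)^{j/2}`. -/
noncomputable def Fq (a : ℕ → ℝ) (j : ℕ) (s : ℝ) : ℝ :=
  iteratedDeriv j (fulcrum a) s / (iteratedDeriv 2 (fulcrum a) s) ^ ((j : ℝ) / 2)

/-- Tuples `(m₂, …, m_n)` of non-negative integers with `2m₂ + ⋯ + n m_n = n`,
padded with `m₀ = m₁ = 0` and encoded as functions on `Fin (n+1)`. -/
def tuples (n : ℕ) : Finset (Fin (n + 1) → ℕ) :=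
  (Fintype.piFinset fun _ : Fin (n + 1) => Finset.range (n + 1)).filter
    fun m => m 0 = 0 ∧ m 1 = 0 ∧ ∑ j : Fin (n + 1), (j : ℕ) * m j = n

/-- Integer moments of a standard normal random variable `Z`. -/
noncomputable def gaussMoment (k : ℕ) : ℝ :=
  if Even k then (Nat.factorial k : ℝ) / ((Nat.factorial (k / 2) : ℝ) * 2 ^ (k / 2)) else 0

/-- The complex power series sum. -/
noncomputable def fsumC (a : ℕ → ℝ) (z : ℂ) : ℂ := ∑' n : ℕ, (a n : ℂ) * z ^ n

/-- The complex fulcrum `F(z) = log f(e^z)`. -/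
noncomputable def fulcrumC (a : ℕ → ℝ) (z : ℂ) : ℂ := Complex.log (fsumC a (Complex.exp z))

end KhinchinPaper

namespace KhinchinPaper

open MeasureTheory ProbabilityTheory

/-- Moments are expressed through cumulants and lower moments. -/
lemma integral_pow_succ_eq_sum_cumulant {Ω : Type*} {mΩ : MeasurableSpace Ω} {μ : Measure Ω}
    [IsProbabilityMeasure μ] {X : Ω → ℝ} (h : 0 ∈ interior (integrableExpSet X μ)) (k : ℕ) :
    ∫ ω, X ω ^ (k + 1) ∂μ = ∑ i ∈ Finset.range (k + 1),
      (k.choose i : ℝ) * iteratedDeriv (i + 1) (cgf X μ) 0 * ∫ ω, X ω ^ (k - i) ∂μ := by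
  have hm (j : ℕ) : ∫ ω, X ω ^ j ∂μ = iteratedDeriv j (mgf X μ) 0 := by
    simp [iteratedDeriv_mgf_zero h]
  have hderiv : deriv (mgf X μ) =ᶠ[𝓝 0] deriv (cgf X μ) * mgf X μ := by
    filter_upwards [isOpen_interior.mem_nhds h] with u hu
    have hpos : mgf X μ u ≠ 0 :=
      (mgf_pos (X := X) (interior_subset hu : u ∈ integrableExpSet X μ)).ne'
    have := ((differentiableAt_mgf hu).hasDerivAt.log hpos).deriv
    change deriv (cgf X μ) u = _ at this
    rw [Pi.mul_apply, this, div_mul_cancel₀ _ hpos]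
  rw [hm, iteratedDeriv_succ', hderiv.iteratedDeriv_eq k,
    iteratedDeriv_mul (analyticAt_cgf h).deriv.contDiffAt (analyticAt_mgf h).contDiffAt]
  simp only [hm, iteratedDeriv_succ']

/-- Replacing a power by its truncation costs at most a higher even moment. -/
lemma abs_pow_sub_clip_pow_le {A x : ℝ} (hA : 1 ≤ A) {k n : ℕ} (hkn : k < n) (hn : Even n) :
    |x ^ k - max (-A) (min x A) ^ k| ≤ 2 * x ^ n / A := by
  have hA0 : 0 < A := by linarith
  rcases le_or_gt |x| A with hx | hx
  · rw [abs_le] at hx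
    rw [min_eq_left hx.2, max_eq_right hx.1, sub_self, abs_zero]
    have := hn.pow_nonneg x
    positivity
  · have hclip : |max (-A) (min x A)| ≤ |x| := by
      refine (abs_le.2 ⟨le_max_left _ _, max_le (by linarith) (min_le_right _ _)⟩).trans hx.le
    have h1 : |x| ^ k * A ≤ x ^ n := by
      rw [← hn.pow_abs]
      calc |x| ^ k * A ≤ |x| ^ k * |x| := by gcongr
        _ = |x| ^ (k + 1) := (pow_succ _ _).symm
        _ ≤ |x| ^ n := pow_le_pow_right₀ (by linarith) hkn
    have h2 : |max (-A) (min x A)| ^ k ≤ |x| ^ k := by gcongr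
    calc _ ≤ |x ^ k| + |max (-A) (min x A) ^ k| := abs_sub _ _
      _ ≤ |x| ^ k + |x| ^ k := by rw [abs_pow, abs_pow]; gcongr
      _ ≤ _ := by rw [le_div_iff₀ hA0]; linarith

/-- Truncation of a power, as a bounded continuous function. -/
noncomputable def clipPow (A : ℝ) (k : ℕ) : BoundedContinuousFunction ℝ ℝ :=
  BoundedContinuousFunction.ofNormedAddCommGroup (fun x => max (-|A|) (min x |A|) ^ k)
    (by fun_prop) (|A| ^ k) fun x => by
      rw [Real.norm_eq_abs, abs_pow]
      refine pow_le_pow_left₀ (abs_nonneg _) ?_ k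
      exact abs_le.2 ⟨le_max_left _ _, max_le (neg_le_self (abs_nonneg A)) (min_le_right _ _)⟩

lemma abs_integral_pow_sub_integral_clipPow_le {P : Measure ℝ} [IsProbabilityMeasure P]
    (hint : ∀ k : ℕ, Integrable (fun x : ℝ => x ^ k) P) {A : ℝ} (hA : 1 ≤ A) {k n : ℕ}
    (hkn : k < n) (hn : Even n) :
    |∫ x, x ^ k ∂P - ∫ x, clipPow A k x ∂P| ≤ 2 * (∫ x, x ^ n ∂P) / A := by
  rw [← integral_sub (hint k) ((clipPow A k).integrable P), ← integral_const_mul,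
    ← integral_div, ← Real.norm_eq_abs]
  refine norm_integral_le_of_norm_le (((hint n).const_mul 2).div_const A) (ae_of_all _ fun x => ?_)
  have := abs_pow_sub_clip_pow_le (x := x) hA hkn hn
  simpa [clipPow, abs_of_pos (zero_lt_one.trans_le hA)] using this

/-- Weak convergence and boundedness of an even moment imply convergence of lower moments. -/
lemma tendsto_integral_pow_of_tendsto {ι : Type*} {l : Filter ι} {P : ι → ProbabilityMeasure ℝ}
    {Q : ProbabilityMeasure ℝ} (hPQ : Tendsto P l (𝓝 Q))
    (hP : ∀ i, ∀ k : ℕ, Integrable (fun x : ℝ => x ^ k) (P i : Measure ℝ))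
    (hQ : ∀ k : ℕ, Integrable (fun x : ℝ => x ^ k) (Q : Measure ℝ)) {n : ℕ} (hn : Even n)
    (hb : (fun i => ∫ x, x ^ n ∂(P i : Measure ℝ)) =O[l] fun _ => (1 : ℝ)) {k : ℕ} (hkn : k < n) :
    Tendsto (fun i => ∫ x, x ^ k ∂(P i : Measure ℝ)) l (𝓝 (∫ x, x ^ k ∂(Q : Measure ℝ))) := by
  rw [ProbabilityMeasure.tendsto_iff_forall_integral_tendsto] at hPQ
  obtain ⟨C, hC⟩ := hb.bound
  set D := max (max C (∫ x, x ^ n ∂(Q : Measure ℝ))) 1 with hD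
  have hD0 : 0 < D := lt_max_of_lt_right one_pos
  rw [Metric.tendsto_nhds]
  intro ε hε
  set A := max 1 (8 * D / ε) with hAdef
  have hA : 1 ≤ A := le_max_left _ _
  have hA0 : 0 < A := by linarith
  have hDA : 2 * D / A ≤ ε / 4 := by
    have : 8 * D / ε ≤ A := le_max_right _ _
    rw [div_le_iff₀ hε] at this
    rw [div_le_iff₀ hA0]
    linarith
  filter_upwards [hC, Metric.tendsto_nhds.1 (hPQ (clipPow A k)) (ε / 4) (by positivity)]
    with i hi hi'
  have key (S : ProbabilityMeasure ℝ) (hS : ∀ k : ℕ, Integrable (fun x : ℝ => x ^ k) (S : Measure ℝ))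
      (hSD : ∫ x, x ^ n ∂(S : Measure ℝ) ≤ D) :
      |∫ x, x ^ k ∂(S : Measure ℝ) - ∫ x, clipPow A k x ∂(S : Measure ℝ)| ≤ ε / 4 :=
    (abs_integral_pow_sub_integral_clipPow_le hS hA hkn hn).trans <| le_trans (by gcongr) hDA
  have h1 := key (P i) (hP i) <| by
    refine (le_abs_self _).trans (le_trans (by simpa using hi) ?_)
    exact (le_max_left _ _).trans (le_max_left _ _)
  have h2 := key Q hQ ((le_max_right _ _).trans (le_max_left _ _))
  rw [Real.dist_eq] at hi' ⊢
  rw [abs_le] at h1 h2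
  rw [abs_lt] at hi' ⊢
  constructor <;> linarith [h1.1, h1.2, h2.1, h2.2, hi'.1, hi'.2]

/-- Bounded cumulants give bounded moments. -/
lemma isBigO_integral_pow_of_isBigO_cumulant {ι : Type*} {l : Filter ι}
    {P : ι → ProbabilityMeasure ℝ}
    (hP : ∀ i, 0 ∈ interior (integrableExpSet id (P i : Measure ℝ))) {n : ℕ}
    (hb : ∀ j, 1 ≤ j → j ≤ n →
      (fun i => iteratedDeriv j (cgf id (P i : Measure ℝ)) 0) =O[l] fun _ => (1 : ℝ))
    {k : ℕ} (hk : k ≤ n) :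
    (fun i => ∫ x, x ^ k ∂(P i : Measure ℝ)) =O[l] fun _ => (1 : ℝ) := by
  induction k using Nat.strong_induction_on with
  | _ k ih =>
    rcases k with _ | k
    · simpa using Asymptotics.isBigO_refl (fun _ => (1 : ℝ)) l
    · have hrec (i : ι) := integral_pow_succ_eq_sum_cumulant (hP i) k
      simp only [id] at hrec
      simp only [hrec]
      refine Asymptotics.IsBigO.fun_sum fun j hj => ?_
      rw [Finset.mem_range] at hj
      have h1 := (hb (j + 1) (by omega) (by omega)).const_mul_left (k.choose j : ℝ)
      simpa using h1.mul (ih (k - j) (by omega) (by omega))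

/-- Weak convergence and bounded cumulants up to an even order imply convergence of the cumulants
of lower order. -/
lemma tendsto_cumulant_of_tendsto {ι : Type*} {l : Filter ι} {P : ι → ProbabilityMeasure ℝ}
    {Q : ProbabilityMeasure ℝ} (hPQ : Tendsto P l (𝓝 Q))
    (hP : ∀ i, 0 ∈ interior (integrableExpSet id (P i : Measure ℝ)))
    (hQ : 0 ∈ interior (integrableExpSet id (Q : Measure ℝ))) {n : ℕ} (hn : Even n)
    (hb : ∀ j, 1 ≤ j → j ≤ n →
      (fun i => iteratedDeriv j (cgf id (P i : Measure ℝ)) 0) =O[l] fun _ => (1 : ℝ))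
    {j : ℕ} (hj : 1 ≤ j) (hjn : j < n) :
    Tendsto (fun i => iteratedDeriv j (cgf id (P i : Measure ℝ)) 0) l
      (𝓝 (iteratedDeriv j (cgf id (Q : Measure ℝ)) 0)) := by
  have hm {k : ℕ} (hk : k < n) := tendsto_integral_pow_of_tendsto hPQ
    (fun i => integrable_pow_of_mem_interior_integrableExpSet (hP i))
    (integrable_pow_of_mem_interior_integrableExpSet hQ) hn
    (isBigO_integral_pow_of_isBigO_cumulant hP hb le_rfl) hk
  have hrec (S : ProbabilityMeasure ℝ) (hS : 0 ∈ interior (integrableExpSet id (S : Measure ℝ)))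
      (k : ℕ) : iteratedDeriv (k + 1) (cgf id (S : Measure ℝ)) 0 =
        ∫ x, x ^ (k + 1) ∂(S : Measure ℝ) - ∑ i ∈ Finset.range k, (k.choose i : ℝ) *
          iteratedDeriv (i + 1) (cgf id (S : Measure ℝ)) 0 * ∫ x, x ^ (k - i) ∂(S : Measure ℝ) := by
    have := integral_pow_succ_eq_sum_cumulant hS k
    rw [Finset.sum_range_succ] at this
    simp only [id, Nat.choose_self, Nat.sub_self, pow_zero, integral_const, probReal_univ,
      smul_eq_mul, mul_one, Nat.cast_one, one_mul] at this
    rw [this]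
    ring
  induction j using Nat.strong_induction_on with
  | _ j ih =>
    obtain ⟨k, rfl⟩ : ∃ k, j = k + 1 := ⟨j - 1, by omega⟩
    rw [hrec Q hQ k]
    refine Tendsto.congr (fun i => (hrec (P i) (hP i) k).symm) ?_
    refine (hm hjn).sub (tendsto_finsetSum _ fun i hi => ?_)
    rw [Finset.mem_range] at hi
    exact ((ih (i + 1) (by omega) (by omega) (by omega)).const_mul _).mul (hm (by omega))

lemma iteratedDeriv_cgf_gaussianReal_eq_zero {j : ℕ} (hj : 3 ≤ j) :
    iteratedDeriv j (cgf id (gaussianReal 0 1)) 0 = 0 := by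
  have : cgf id (gaussianReal 0 1) = fun u : ℝ => u ^ 2 / 2 := by
    ext u
    rw [cgf_gaussianReal (μ := 0) (v := 1) (by simp)]
    simp
  rw [this, iteratedDeriv_div_const, iteratedDeriv_fun_pow_zero, if_neg (by omega)]
  simp

lemma iteratedDeriv_comp_const_add_mul (j : ℕ) (f : ℝ → ℝ) (s c : ℝ) :
    iteratedDeriv j (fun u => f (s + c * u)) = fun u => c ^ j * iteratedDeriv j f (s + c * u) := by
  induction j with
  | zero => simp
  | succ j ih =>
    ext u
    rw [iteratedDeriv_succ, ih, deriv_const_mul_field,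
      deriv_comp_mul_left c (fun v => iteratedDeriv j f (s + v)), deriv_comp_const_add,
      ← iteratedDeriv_succ, smul_eq_mul, pow_succ]
    ring

/-- Law of `c * (X - m)`, where `X` is the member at parameter `t` of the Khinchin family. -/
noncomputable def khinchinLaw (a : ℕ → ℝ) (t m c : ℝ) : Measure ℝ :=
  Measure.sum fun n : ℕ => ENNReal.ofReal (a n * t ^ n / fsum a t) •
    Measure.dirac (c * ((n : ℝ) - m))

section Law

variable {a : ℕ → ℝ} {R t : ℝ}

lemma IsK.fsum_pos (hK : IsK a R) (ht : 0 ≤ t) (htR : t < R) : 0 < fsum a t :=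
  (hK.conv t ht htR).tsum_pos (fun n => mul_nonneg (hK.nonneg n) (pow_nonneg ht n)) 0
    (by simpa using hK.pos₀)

lemma IsK.weight_nonneg (hK : IsK a R) (ht : 0 ≤ t) (n : ℕ) : 0 ≤ a n * t ^ n / fsum a t :=
  have h (n : ℕ) : 0 ≤ a n * t ^ n := mul_nonneg (hK.nonneg n) (pow_nonneg ht n)
  div_nonneg (h n) (tsum_nonneg h)

lemma IsK.isProbabilityMeasure_khinchinLaw (hK : IsK a R) (ht : 0 ≤ t) (htR : t < R) (m c : ℝ) :
    IsProbabilityMeasure (khinchinLaw a t m c) := by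
  have h : HasSum (fun n => a n * t ^ n / fsum a t) 1 := by
    have := (hK.conv t ht htR).hasSum.div_const (fsum a t)
    rwa [← fsum, div_self (hK.fsum_pos ht htR).ne'] at this
  exact h.isProbabilityMeasure_sum_dirac (hK.weight_nonneg ht)

lemma IsK.integrable_khinchinLaw_iff (hK : IsK a R) (ht : 0 ≤ t) (m c : ℝ) {E : Type*}
    [NormedAddCommGroup E] {φ : ℝ → E} : Integrable φ (khinchinLaw a t m c) ↔
      Summable fun n : ℕ => a n * t ^ n / fsum a t * ‖φ (c * ((n : ℝ) - m))‖ := by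
  rw [khinchinLaw, integrable_sum_dirac_iff (by simp)]
  simp only [ENNReal.toReal_ofReal (hK.weight_nonneg ht _)]

lemma IsK.integral_khinchinLaw (hK : IsK a R) (ht : 0 ≤ t) (m c : ℝ) {E : Type*}
    [NormedAddCommGroup E] [NormedSpace ℝ E] [FiniteDimensional ℝ E] (φ : ℝ → E) :
    ∫ x, φ x ∂(khinchinLaw a t m c) =
      ∑' n : ℕ, (a n * t ^ n / fsum a t) • φ (c * ((n : ℝ) - m)) := by
  rw [khinchinLaw, integral_sum_dirac (by simp)]
  simp only [ENNReal.toReal_ofReal (hK.weight_nonneg ht _)]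

lemma IsK.charFun_khinchinLaw (hK : IsK a R) (ht : 0 ≤ t) (θ : ℝ) :
    charFun (khinchinLaw a t (mf a t) (sigma a t)⁻¹) θ = charfun a t θ := by
  rw [charFun_apply_real, hK.integral_khinchinLaw ht, charfun]
  refine tsum_congr fun n => ?_
  rw [Complex.real_smul]
  congr 2
  push_cast
  ring

end Law

section Cumulants

variable {a : ℕ → ℝ} {R s : ℝ}

lemma weight_mul_exp (a : ℕ → ℝ) (s m c u : ℝ) (n : ℕ) :
    a n * Real.exp s ^ n / fsum a (Real.exp s) * Real.exp (u * (c * ((n : ℝ) - m))) =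
      a n * Real.exp (s + c * u) ^ n * (Real.exp (-(u * (c * m))) / fsum a (Real.exp s)) := by
  have : Real.exp s ^ n * Real.exp (u * (c * ((n : ℝ) - m))) =
      Real.exp (s + c * u) ^ n * Real.exp (-(u * (c * m))) := by
    rw [← Real.exp_nat_mul, ← Real.exp_nat_mul, ← Real.exp_add, ← Real.exp_add]
    congr 1
    ring
  linear_combination (a n / fsum a (Real.exp s)) * this

lemma IsK.exp_lt (hK : IsK a R) (hs : s < Real.log R) : Real.exp s < R :=
  (Real.lt_log_iff_exp_lt hK.Rpos).1 hs

lemma eventually_add_mul_lt (hs : s < Real.log R) (c : ℝ) :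
    ∀ᶠ u : ℝ in 𝓝 0, s + c * u < Real.log R :=
  (by fun_prop : Continuous fun u : ℝ => s + c * u).continuousAt.eventually_lt_const (by simpa)

lemma IsK.zero_mem_interior_integrableExpSet (hK : IsK a R) (hs : s < Real.log R) (m c : ℝ) :
    0 ∈ interior (integrableExpSet id (khinchinLaw a (Real.exp s) m c)) := by
  rw [mem_interior_iff_mem_nhds]
  filter_upwards [eventually_add_mul_lt hs c] with u hu
  change Integrable (fun x => Real.exp (u * x)) _
  rw [hK.integrable_khinchinLaw_iff (Real.exp_pos s).le]
  simp only [Real.norm_eq_abs, Real.abs_exp, weight_mul_exp]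
  exact (hK.conv _ (Real.exp_pos _).le (hK.exp_lt hu)).mul_right _

lemma IsK.cgf_khinchinLaw (hK : IsK a R) (hs : s < Real.log R) (m c : ℝ) :
    cgf id (khinchinLaw a (Real.exp s) m c) =ᶠ[𝓝 0]
      fun u => fulcrum a (s + c * u) - (fulcrum a s + u * (c * m)) := by
  filter_upwards [eventually_add_mul_lt hs c] with u hu
  have hpos := hK.fsum_pos (Real.exp_pos _).le (hK.exp_lt hu)
  have hpos' := hK.fsum_pos (Real.exp_pos _).le (hK.exp_lt hs)
  have : mgf id (khinchinLaw a (Real.exp s) m c) u =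
      fsum a (Real.exp (s + c * u)) * (Real.exp (-(u * (c * m))) / fsum a (Real.exp s)) := by
    change ∫ x, Real.exp (u * x) ∂_ = _
    rw [hK.integral_khinchinLaw (Real.exp_pos s).le]
    simp only [smul_eq_mul, weight_mul_exp]
    exact tsum_mul_right
  rw [cgf, this, Real.log_mul hpos.ne' (by positivity), Real.log_div (by positivity) hpos'.ne',
    Real.log_exp, fulcrum, fulcrum]
  ring

lemma IsK.analyticAt_fulcrum (hK : IsK a R) (hs : s < Real.log R) :
    AnalyticAt ℝ (fulcrum a) s := by
  have h := (analyticAt_cgf (hK.zero_mem_interior_integrableExpSet hs 0 1)).congr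
    (hK.cgf_khinchinLaw hs 0 1)
  have h2 : AnalyticAt ℝ (fun u => fulcrum a (s + u)) 0 := by
    refine (h.add (analyticAt_const (v := fulcrum a s))).congr (.of_forall fun u => ?_)
    simp
  have h3 := AnalyticAt.comp_of_eq (f := fun v => v - s) (x := s) h2 (by fun_prop) (by simp)
  refine h3.congr (.of_forall fun u => ?_)
  simp

lemma IsK.iteratedDeriv_cgf_khinchinLaw (hK : IsK a R) (hs : s < Real.log R) (m c : ℝ) {j : ℕ}
    (hj : 1 ≤ j) : iteratedDeriv j (cgf id (khinchinLaw a (Real.exp s) m c)) 0 =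
      c ^ j * iteratedDeriv j (fulcrum a) s - if j = 1 then c * m else 0 := by
  have hF : ContDiffAt ℝ j (fun u => fulcrum a (s + c * u)) 0 := by
    refine ContDiffAt.comp (g := fulcrum a) 0 ?_ (by fun_prop)
    simpa using (hK.analyticAt_fulcrum hs).contDiffAt
  rw [(hK.cgf_khinchinLaw hs m c).iteratedDeriv_eq j, iteratedDeriv_fun_sub hF (by fun_prop),
    iteratedDeriv_comp_const_add_mul, iteratedDeriv_const_add hj, iteratedDeriv_mul_const_field,
    iteratedDeriv_fun_id_zero]
  simp

lemma IsK.mf_eq_integral (hK : IsK a R) {t : ℝ} (ht : 0 ≤ t) :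
    mf a t = ∫ x, x ∂(khinchinLaw a t 0 1) := by
  rw [hK.integral_khinchinLaw ht, mf, ← tsum_div_const]
  refine tsum_congr fun n => ?_
  simp
  ring

lemma IsK.sigma2_eq_integral (hK : IsK a R) {t : ℝ} (ht : 0 ≤ t) :
    sigma2 a t = ∫ x, x ^ 2 ∂(khinchinLaw a t 0 1) - mf a t ^ 2 := by
  rw [hK.integral_khinchinLaw ht, sigma2, ← tsum_div_const]
  congr 1
  refine tsum_congr fun n => ?_
  simp
  ring

lemma IsK.iteratedDeriv_one_fulcrum (hK : IsK a R) (hs : s < Real.log R) :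
    iteratedDeriv 1 (fulcrum a) s = mf a (Real.exp s) := by
  have := hK.isProbabilityMeasure_khinchinLaw (Real.exp_pos s).le (hK.exp_lt hs) 0 1
  have h := hK.iteratedDeriv_cgf_khinchinLaw hs 0 1 le_rfl
  rw [iteratedDeriv_one, deriv_cgf_zero (hK.zero_mem_interior_integrableExpSet hs 0 1)] at h
  simpa [hK.mf_eq_integral (Real.exp_pos s).le] using h.symm

lemma IsK.iteratedDeriv_two_fulcrum (hK : IsK a R) (hs : s < Real.log R) :
    iteratedDeriv 2 (fulcrum a) s = sigma2 a (Real.exp s) := by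
  have := hK.isProbabilityMeasure_khinchinLaw (Real.exp_pos s).le (hK.exp_lt hs) 0 1
  have h := hK.iteratedDeriv_cgf_khinchinLaw hs 0 1 one_le_two
  have hint := hK.zero_mem_interior_integrableExpSet hs 0 1
  rw [iteratedDeriv_two_cgf hint, deriv_cgf_zero hint] at h
  simpa [hK.sigma2_eq_integral, hK.mf_eq_integral, (Real.exp_pos s).le] using h.symm

lemma IsK.mf_pos (hK : IsK a R) (hs : s < Real.log R) : 0 < mf a (Real.exp s) := by
  obtain ⟨n, hn, han⟩ := hK.nonconst
  have h0 := (Real.exp_pos s).le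
  have hf := hK.fsum_pos h0 (hK.exp_lt hs)
  have hint : Integrable (fun x : ℝ => x) (khinchinLaw a (Real.exp s) 0 1) :=
    integrable_of_mem_interior_integrableExpSet (hK.zero_mem_interior_integrableExpSet hs 0 1)
  rw [hK.integrable_khinchinLaw_iff h0] at hint
  rw [hK.mf_eq_integral h0, hK.integral_khinchinLaw h0]
  simp only [one_mul, sub_zero, Real.norm_natCast, smul_eq_mul] at hint ⊢
  exact hint.tsum_pos (fun k => mul_nonneg (hK.weight_nonneg h0 k) k.cast_nonneg) n (by positivity)

lemma IsK.sigma2_pos (hK : IsK a R) (hs : s < Real.log R) : 0 < sigma2 a (Real.exp s) := by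
  have h0 := (Real.exp_pos s).le
  have hf := hK.fsum_pos h0 (hK.exp_lt hs)
  have hm := hK.mf_pos hs
  have ha := hK.pos₀
  have := hK.isProbabilityMeasure_khinchinLaw h0 (hK.exp_lt hs) (mf a (Real.exp s)) 1
  have hmem := hK.zero_mem_interior_integrableExpSet hs (mf a (Real.exp s)) 1
  have h := hK.iteratedDeriv_cgf_khinchinLaw hs (mf a (Real.exp s)) 1 one_le_two
  have h1 := hK.iteratedDeriv_cgf_khinchinLaw hs (mf a (Real.exp s)) 1 le_rfl
  rw [hK.iteratedDeriv_one_fulcrum hs, iteratedDeriv_one] at h1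
  rw [hK.iteratedDeriv_two_fulcrum hs, iteratedDeriv_two_cgf hmem, h1] at h
  have h' : sigma2 a (Real.exp s) =
      ∫ x, x ^ 2 ∂(khinchinLaw a (Real.exp s) (mf a (Real.exp s)) 1) := by
    simpa using h.symm
  have hint := integrable_pow_of_mem_interior_integrableExpSet hmem 2
  rw [hK.integrable_khinchinLaw_iff h0] at hint
  rw [h', hK.integral_khinchinLaw h0]
  simp only [one_mul, id, norm_pow, Real.norm_eq_abs, sq_abs, smul_eq_mul] at hint ⊢
  refine hint.tsum_pos (fun k => mul_nonneg (hK.weight_nonneg h0 k) (sq_nonneg _)) 0 ?_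
  simp only [pow_zero, mul_one, Nat.cast_zero, zero_sub, neg_sq]
  positivity

lemma IsK.iteratedDeriv_one_cgf_normalized (hK : IsK a R) (hs : s < Real.log R) :
    iteratedDeriv 1 (cgf id (khinchinLaw a (Real.exp s) (mf a (Real.exp s))
      (sigma a (Real.exp s))⁻¹)) 0 = 0 := by
  rw [hK.iteratedDeriv_cgf_khinchinLaw hs _ _ le_rfl, hK.iteratedDeriv_one_fulcrum hs]
  simp

lemma IsK.iteratedDeriv_cgf_normalized (hK : IsK a R) (hs : s < Real.log R) {j : ℕ}
    (hj : 2 ≤ j) : iteratedDeriv j (cgf id (khinchinLaw a (Real.exp s) (mf a (Real.exp s))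
      (sigma a (Real.exp s))⁻¹)) 0 = Fq a j s := by
  have hpos := hK.sigma2_pos hs
  rw [hK.iteratedDeriv_cgf_khinchinLaw hs _ _ (by omega), Fq, hK.iteratedDeriv_two_fulcrum hs,
    if_neg (by omega), sub_zero, inv_pow, sigma, Real.sqrt_eq_rpow, ← Real.rpow_natCast,
    ← Real.rpow_mul hpos.le, inv_mul_eq_div]
  congr 2
  ring

end Cumulants

/-- partial converse. If `f` is Gaussian and the quotients
`|F^{(j)}(s)|/F''(s)^{j/2}` are bounded as `s ↑ ln R` for `3 ≤ j ≤ n` (`n ≥ 4` even),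
then `F^{(j)}(s)/F''(s)^{j/2} → 0` for `3 ≤ j < n`. -/
theorem statement8 (a : ℕ → ℝ) (R : ℝ) (hK : IsK a R) (hG : IsGaussian a R)
    (n : ℕ) (hn : 4 ≤ n) (hne : Even n)
    (hb : ∀ j : ℕ, 3 ≤ j → j ≤ n →
      IsBoundedUnder (· ≤ ·) (𝓝[<] Real.log R)
        (fun s => |iteratedDeriv j (fulcrum a) s| /
          (iteratedDeriv 2 (fulcrum a) s) ^ ((j : ℝ) / 2))) :
    ∀ j : ℕ, 3 ≤ j → j < n →
      Tendsto (fun s => Fq a j s) (𝓝[<] Real.log R) (𝓝 0) := by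
  have hs (s : Set.Iio (Real.log R)) : (s : ℝ) < Real.log R := s.2
  have h0 (s : ℝ) : 0 ≤ Real.exp s := (Real.exp_pos s).le
  let P (s : Set.Iio (Real.log R)) : ProbabilityMeasure ℝ :=
    ⟨khinchinLaw a (Real.exp s) (mf a (Real.exp s)) (sigma a (Real.exp s))⁻¹,
      hK.isProbabilityMeasure_khinchinLaw (h0 s) (hK.exp_lt (hs s)) _ _⟩
  let Q : ProbabilityMeasure ℝ := ⟨gaussianReal 0 1, inferInstance⟩
  have hexp : Tendsto (fun s : Set.Iio (Real.log R) => Real.exp s) atTop (𝓝[<] R) := by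
    refine tendsto_nhdsWithin_iff.2 ⟨?_, .of_forall fun s => hK.exp_lt (hs s)⟩
    rw [tendsto_comp_coe_Iio_atTop (f := Real.exp)]
    have := Real.continuous_exp.continuousAt (x := Real.log R)
    rw [ContinuousAt, Real.exp_log hK.Rpos] at this
    exact this.mono_left nhdsWithin_le_nhds
  have : (atTop : Filter (Set.Iio (Real.log R))).IsCountablyGenerated := by
    rw [← comap_coe_Iio_nhdsLT]
    infer_instance
  have hPQ : Tendsto P atTop (𝓝 Q) := by
    refine tendsto_of_seq_tendsto fun u hu => ?_
    refine ProbabilityMeasure.tendsto_of_tendsto_charFun fun θ => ?_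
    have h := (hG θ).comp (hexp.comp hu)
    have hQ : charFun (Q : Measure ℝ) θ = Complex.exp (-(θ : ℂ) ^ 2 / 2) := by
      change charFun (gaussianReal 0 1) θ = _
      rw [charFun_gaussianReal]
      congr 1
      simp
      ring
    rw [hQ]
    exact h.congr fun k => (hK.charFun_khinchinLaw (h0 _) θ).symm
  have hb' (j : ℕ) (hj : 1 ≤ j) (hjn : j ≤ n) :
      (fun s => iteratedDeriv j (cgf id (P s : Measure ℝ)) 0) =O[atTop] fun _ => (1 : ℝ) := by
    rcases (by omega : j = 1 ∨ j = 2 ∨ 3 ≤ j) with rfl | rfl | hj3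
    · refine (Asymptotics.isBigO_zero _ _).congr_left fun s => ?_
      exact (hK.iteratedDeriv_one_cgf_normalized (hs s)).symm
    · refine (Asymptotics.isBigO_refl (fun _ => (1 : ℝ)) _).congr_left fun s => ?_
      refine Eq.trans ?_ (hK.iteratedDeriv_cgf_normalized (hs s) le_rfl).symm
      have := hK.sigma2_pos (hs s)
      simp [Fq, hK.iteratedDeriv_two_fulcrum (hs s), this.ne']
    · refine Asymptotics.IsBigO.congr_left (f₁ := fun s : Set.Iio (Real.log R) => Fq a j s) ?_
        fun s => (hK.iteratedDeriv_cgf_normalized (hs s) (by omega)).symm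
      obtain ⟨C, hC⟩ := hb j hj3 hjn
      rw [eventually_map, ← map_coe_Iio_atTop, eventually_map] at hC
      refine Asymptotics.IsBigO.of_bound C (hC.mono fun s h => ?_)
      have := (hK.iteratedDeriv_two_fulcrum (hs s)).symm ▸ hK.sigma2_pos (hs s)
      rw [norm_one, mul_one, Fq, norm_div, Real.norm_eq_abs,
        Real.norm_of_nonneg (Real.rpow_nonneg this.le _)]
      exact h
  intro j hj hjn
  rw [← tendsto_comp_coe_Iio_atTop (f := fun s => Fq a j s),
    ← iteratedDeriv_cgf_gaussianReal_eq_zero hj]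
  refine (tendsto_cumulant_of_tendsto hPQ
    (fun s => hK.zero_mem_interior_integrableExpSet (hs s) _ _)
    (by simp [Q]) hne hb' (by omega) hjn).congr fun s => ?_
  exact hK.iteratedDeriv_cgf_normalized (hs s) (by omega)

end KhinchinPaper
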